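/- Let p be an odd prime, 1 ≤ n ≤ p, and set l = n/2 if n is even, l = (n−1)/2 if n is odd. Then the Hilbert series of the module of covariants k[V_3]^G(V_n) satisfies: if n is odd, (1−t)(1−t^2)(1−t^p)·H(k[V_3]^G(V_n),t) = 1 + 2t + 2t^2 + … + 2t^l + 2t^{p−l} + 2t^{p−l+1} + … + 2t^{p−1} + t^p; if n is even, (1−t)(1−t^2)(1−t^p)·H(k[V_3]^G(V_n),t) = 1 + 2t + 2t^2 + … + 2t^{l−1} + t^l + t^{p−l} + 2t^{p−l+1} + … + 2t^{p−1} + t^p. -/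

import Mathlib

open MvPolynomial

/-- The algebra automorphism `σ` of `k[V_m] = k[x_1,…,x_m]` given by
`σ x_i = x_i + x_{i+1}` for `i < m` and `σ x_m = x_m` (0-indexed). -/
noncomputable def sigmaHom (k : Type*) [CommRing k] (m : ℕ) :
    MvPolynomial (Fin m) k →ₐ[k] MvPolynomial (Fin m) k :=
  aeval (fun i : Fin m =>
    X i + if h : (i : ℕ) + 1 < m then X (⟨(i : ℕ) + 1, h⟩ : Fin m) else 0)

/-- The twisted derivation `Δ = σ - 1` as a `k`-linear endomorphism of `k[V_m]`. -/
noncomputable def delta (k : Type*) [CommRing k] (m : ℕ) :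
    Module.End k (MvPolynomial (Fin m) k) :=
  (sigmaHom k m).toLinearMap - LinearMap.id

/-- Identifying `k[V_m] ⊗ V_n` with `Fin n → k[V_m]` via the basis
`w_1, …, w_n` (0-indexed, `σ w_j = Σ_{i ≤ j} (-1)^{j-i} w_i`), this is the
diagonal action of `σ`:  `(σ·φ) i = Σ_{j ≥ i} (-1)^{j-i} σ(φ j)`.
Covariants are its fixed points. -/
noncomputable def actL (k : Type*) [Field k] (m n : ℕ) :
    (Fin n → MvPolynomial (Fin m) k) →ₗ[k] (Fin n → MvPolynomial (Fin m) k) :=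
  LinearMap.pi fun i =>
    ∑ j : Fin n,
      if (i : ℕ) ≤ (j : ℕ) then
        ((-1 : k) ^ ((j : ℕ) - (i : ℕ))) •
          ((sigmaHom k m).toLinearMap ∘ₗ LinearMap.proj j)
      else 0

/-- The Hilbert series of the module of covariants `k[V_3]^G(V_n)`, as a
formal power series over `ℤ`. -/
noncomputable def covHilbert (k : Type*) [Field k] (n : ℕ) : PowerSeries ℤ :=
  PowerSeries.mk fun d =>
    (Module.finrank k
      ↥(LinearMap.ker (actL k 3 n - LinearMap.id) ⊓
        Submodule.pi Set.univ fun _ : Fin n => homogeneousSubmodule (Fin 3) k d) : ℤ)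

/-- The generating series counting the elements of `S` by degree. -/
noncomputable def fiberSeries {S : Type*} (deg : S → ℕ) : PowerSeries ℤ :=
  PowerSeries.mk fun d => (Nat.card {s // deg s = d} : ℤ)

lemma fiberSeries_fintype {S : Type*} [Fintype S] (deg : S → ℕ) :
    fiberSeries deg = ∑ s, (PowerSeries.X : PowerSeries ℤ) ^ deg s := by
  classical
  ext d
  simp [fiberSeries, PowerSeries.coeff_X_pow, Fintype.card_subtype, eq_comm]

lemma fiberSeries_sumElim {S T : Type*} (f : S → ℕ) (g : T → ℕ)
    (hf : ∀ d, Finite {s // f s = d}) (hg : ∀ d, Finite {t // g t = d}) :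
    fiberSeries (Sum.elim f g) = fiberSeries f + fiberSeries g := by
  ext d
  have : Finite {s // Sum.elim f g (Sum.inl s) = d} := hf d
  have : Finite {t // Sum.elim f g (Sum.inr t) = d} := hg d
  simp only [fiberSeries, PowerSeries.coeff_mk, map_add]
  rw [Nat.card_congr (Equiv.subtypeSum (p := fun x => Sum.elim f g x = d)), Nat.card_sum]
  simp

lemma finite_fiber_sumElim {S T : Type*} (f : S → ℕ) (g : T → ℕ)
    (hf : ∀ d, Finite {s // f s = d}) (hg : ∀ d, Finite {t // g t = d}) (d : ℕ) :
    Finite {s // Sum.elim f g s = d} := by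
  have := hf d
  have := hg d
  exact .of_equiv ({s // f s = d} ⊕ {t // g t = d})
    (Equiv.subtypeSum (p := fun x => Sum.elim f g x = d)).symm

/-- The degree on `ℕ × S` where the first coordinate is an exponent of an element of degree `e`. -/
def coneDeg {S : Type*} (e : ℕ) (deg : S → ℕ) (q : ℕ × S) : ℕ := e * q.1 + deg q.2

lemma finite_fiber_coneDeg {S : Type*} (e : ℕ) (he : 0 < e) (deg : S → ℕ)
    (hf : ∀ d, Finite {s // deg s = d}) (d : ℕ) : Finite {q // coneDeg e deg q = d} := by
  have (d : ℕ) : {s | deg s = d}.Finite := hf d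
  have h : (⋃ b ∈ Set.Iic d, {s | deg s = b}).Finite :=
    (Set.finite_Iic d).biUnion fun b _ => this b
  refine ((Set.finite_Iic d).prod h).subset ?_
  rintro ⟨a, s⟩ (hq : e * a + deg s = d)
  have : a ≤ e * a := Nat.le_mul_of_pos_left a he
  simp only [Set.mem_prod, Set.mem_Iic, Set.mem_iUnion, Set.mem_ofPred_eq, exists_prop,
    exists_eq_right']
  omega

lemma one_sub_X_pow_mul_fiberSeries_coneDeg {S : Type*} (e : ℕ) (he : 0 < e) (deg : S → ℕ)
    (hf : ∀ d, Finite {s // deg s = d}) :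
    (1 - PowerSeries.X ^ e) * fiberSeries (coneDeg e deg) = fiberSeries deg := by
  ext d
  have hfin := finite_fiber_coneDeg e he deg hf
  have := hf d
  rw [sub_mul, one_mul, map_sub, PowerSeries.coeff_X_pow_mul', sub_eq_iff_eq_add]
  simp only [fiberSeries, PowerSeries.coeff_mk]
  have hzero : Nat.card {q : {q // coneDeg e deg q = d} // q.1.1 = 0} =
      Nat.card {s // deg s = d} := Nat.card_congr
    { toFun q := ⟨q.1.1.2, by
        have h1 := q.1.2
        have h2 := q.2
        simpa [coneDeg, h2] using h1⟩
      invFun s := ⟨⟨(0, s.1), by simp [coneDeg, s.2]⟩, rfl⟩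
      left_inv := by
        rintro ⟨⟨⟨a, s⟩, h⟩, ha⟩
        obtain rfl : a = 0 := ha
        rfl
      right_inv _ := rfl }
  rw [← hzero, Nat.card_congr (Equiv.sumCompl
    (fun q : {q // coneDeg e deg q = d} => q.1.1 = 0)).symm, Nat.card_sum, Nat.cast_add,
    add_right_inj]
  split_ifs with hed
  · congr 1
    exact Nat.card_congr
      { toFun q := ⟨(q.1.1.1 - 1, q.1.1.2), by
          obtain ⟨⟨⟨a, s⟩, h⟩, ha⟩ := q
          obtain ⟨a, rfl⟩ := Nat.exists_eq_succ_of_ne_zero ha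
          simp only [coneDeg, Nat.succ_eq_add_one, mul_add] at h ⊢
          simp
          omega⟩
        invFun q := ⟨⟨(q.1.1 + 1, q.1.2), by
          obtain ⟨⟨a, s⟩, h⟩ := q
          simp only [coneDeg, mul_add] at h ⊢
          omega⟩, by simp⟩
        left_inv := by
          rintro ⟨⟨⟨a, s⟩, h⟩, ha⟩
          obtain ⟨a, rfl⟩ := Nat.exists_eq_succ_of_ne_zero ha
          simp
        right_inv _ := by simp }
  · rw [Nat.cast_eq_zero]
    refine Nat.card_eq_zero.2 (Or.inl ⟨?_⟩)
    rintro ⟨⟨⟨a, s⟩, h⟩, ha⟩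
    have : e ≤ e * a := Nat.le_mul_of_pos_right e (Nat.pos_of_ne_zero ha)
    simp only [coneDeg] at h
    omega

lemma one_sub_X_pow_ne_zero (e : ℕ) (he : 0 < e) :
    (1 - PowerSeries.X ^ e : PowerSeries ℤ) ≠ 0 := by
  intro h
  simpa [he.ne'] using congrArg PowerSeries.constantCoeff h

/-- Exponents `(a, i, j)` with a choice of generator, or `(a, j)` with a shift `i < l`. -/
abbrev JordanIndex (l : ℕ) : Type := ℕ × ((ℕ × ℕ × Bool) ⊕ (ℕ × Fin l))

/-- The degree of the socle element attached to an index. -/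
def JordanIndex.deg (p l : ℕ) : JordanIndex l → ℕ :=
  coneDeg p (Sum.elim (coneDeg 1 (coneDeg 2 fun b => bif b then p else l))
    (coneDeg 2 fun i => p - 1 - i))

lemma JordanIndex.finite_fiber (p l : ℕ) (hp : 0 < p) (d : ℕ) :
    Finite {s // JordanIndex.deg p l s = d} :=
  finite_fiber_coneDeg _ hp _ (finite_fiber_sumElim _ _
    (finite_fiber_coneDeg _ one_pos _ (finite_fiber_coneDeg _ two_pos _ fun _ => inferInstance))
    (finite_fiber_coneDeg _ two_pos _ fun _ => inferInstance)) d

lemma one_sub_X_mul_sum_X_pow_sub (p l : ℕ) (hl : l < p) :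
    (1 - PowerSeries.X) * ∑ i : Fin l, (PowerSeries.X : PowerSeries ℤ) ^ (p - 1 - (i : ℕ)) =
      PowerSeries.X ^ (p - l) - PowerSeries.X ^ p := by
  induction l with
  | zero => simp
  | succ l ih =>
    rw [Fin.sum_univ_castSucc, mul_add]
    simp only [Fin.val_castSucc, Fin.val_last]
    rw [ih (by omega), show p - l = p - 1 - l + 1 by omega, show p - (l + 1) = p - 1 - l by omega]
    ring

lemma JordanIndex.fiberSeries_deg (p l : ℕ) (hl : l < p) :
    (1 - PowerSeries.X) * (1 - PowerSeries.X ^ 2) * (1 - PowerSeries.X ^ p) *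
      fiberSeries (JordanIndex.deg p l) = PowerSeries.X ^ l + PowerSeries.X ^ (p - l) := by
  have hp : 0 < p := by omega
  have h2 := fun (f : Bool → ℕ) => finite_fiber_coneDeg 2 two_pos f fun _ => inferInstance
  have h3 := fun (f : Fin l → ℕ) => finite_fiber_coneDeg 2 two_pos f fun _ => inferInstance
  have h1 := fun (f : Bool → ℕ) => finite_fiber_coneDeg 1 one_pos _ (h2 f)
  rw [mul_assoc, JordanIndex.deg, one_sub_X_pow_mul_fiberSeries_coneDeg p hp _
    (finite_fiber_sumElim _ _ (h1 _) (h3 _)), fiberSeries_sumElim _ _ (h1 _) (h3 _), mul_add,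
    mul_right_comm, mul_assoc _ (1 - PowerSeries.X ^ 2) (fiberSeries (coneDeg 2 _)),
    one_sub_X_pow_mul_fiberSeries_coneDeg 2 two_pos _ fun _ => inferInstance,
    fiberSeries_fintype (fun i : Fin l => p - 1 - (i : ℕ)), one_sub_X_mul_sum_X_pow_sub p l hl]
  have h := one_sub_X_pow_mul_fiberSeries_coneDeg 1 one_pos _ (h2 fun b => bif b then p else l)
  rw [pow_one] at h
  rw [h, mul_comm, one_sub_X_pow_mul_fiberSeries_coneDeg 2 two_pos _ fun _ => inferInstance,
    fiberSeries_fintype]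
  simp
  ring

lemma sum_range_X_pow_add_X_pow_sub (p l : ℕ) (hl : 2 * l + 1 ≤ p) :
    ∑ r ∈ Finset.range (2 * l + 1), ((PowerSeries.X : PowerSeries ℤ) ^ ((r + 1) / 2) +
      PowerSeries.X ^ (p - (r + 1) / 2)) =
    1 + (∑ i ∈ Finset.Icc 1 l, 2 * PowerSeries.X ^ i)
      + (∑ i ∈ Finset.Icc (p - l) (p - 1), 2 * PowerSeries.X ^ i)
      + (PowerSeries.X : PowerSeries ℤ) ^ p := by
  induction l with
  | zero => simp [show 0 < p by omega]
  | succ l ih =>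
    have hI : Finset.Icc (p - (l + 1)) (p - 1) =
        insert (p - (l + 1)) (Finset.Icc (p - l) (p - 1)) := by
      ext i
      simp only [Finset.mem_insert, Finset.mem_Icc]
      omega
    rw [show 2 * (l + 1) + 1 = 2 * l + 1 + 1 + 1 by ring, Finset.sum_range_succ,
      Finset.sum_range_succ, ih (by omega), Finset.sum_Icc_succ_top (by omega), hI,
      Finset.sum_insert (by simp; omega), show (2 * l + 1 + 1) / 2 = l + 1 by omega,
      show (2 * l + 1 + 1 + 1) / 2 = l + 1 by omega]
    ring

lemma one_sub_X_mul_sum_Icc (a b : ℕ) (hab : a ≤ b + 1) :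
    (1 - PowerSeries.X) * ∑ i ∈ Finset.Icc a b, 2 * (PowerSeries.X : PowerSeries ℤ) ^ i =
      2 * PowerSeries.X ^ a - 2 * PowerSeries.X ^ (b + 1) := by
  have h := geom_sum_Ico_mul (PowerSeries.X : PowerSeries ℤ) hab
  rw [Finset.Ico_add_one_right_eq_Icc] at h
  rw [← Finset.mul_sum]
  linear_combination -2 * h

lemma sum_fiberSeries_jordanIndex (p : ℕ) (hodd : Odd p) :
    (1 - PowerSeries.X ^ 1) * ((1 - PowerSeries.X ^ 1) * ((1 - PowerSeries.X ^ 1) *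
      ∑ r ∈ Finset.range p, fiberSeries (JordanIndex.deg p ((r + 1) / 2)))) = 1 := by
  obtain ⟨h, rfl⟩ := hodd
  refine mul_left_cancel₀ (mul_ne_zero (one_sub_X_pow_ne_zero 2 two_pos)
    (one_sub_X_pow_ne_zero (2 * h + 1) (by omega))) ?_
  calc _ = (1 - PowerSeries.X) ^ 2 * ∑ r ∈ Finset.range (2 * h + 1),
        (1 - PowerSeries.X) * (1 - PowerSeries.X ^ 2) * (1 - PowerSeries.X ^ (2 * h + 1)) *
          fiberSeries (JordanIndex.deg (2 * h + 1) ((r + 1) / 2)) := by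
        rw [← Finset.mul_sum]
        ring
    _ = (1 - PowerSeries.X) ^ 2 * ∑ r ∈ Finset.range (2 * h + 1),
        (PowerSeries.X ^ ((r + 1) / 2) + PowerSeries.X ^ (2 * h + 1 - (r + 1) / 2)) := by
        congr 1
        refine Finset.sum_congr rfl fun r hr => JordanIndex.fiberSeries_deg _ _ ?_
        have := Finset.mem_range.1 hr
        omega
    _ = _ := by
        rw [sum_range_X_pow_add_X_pow_sub _ h le_rfl, show 2 * h + 1 - h = h + 1 by omega,
          Nat.add_sub_cancel]
        linear_combination (1 - PowerSeries.X) * (one_sub_X_mul_sum_Icc 1 h (by omega) +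
          one_sub_X_mul_sum_Icc (h + 1) (2 * h) (by omega))

/-- If `ker T ⊓ range (T ^ r)` contains, inside the finite-dimensional space `W`, images under
`T ^ r` of elements of `W` forming independent families of sizes `g r`, and these sizes add up to
at least `dim W`, then they determine the dimensions of the kernels of the powers of `T`. -/
lemma finrank_ker_pow_inf_eq_sum {k M : Type*} [Field k] [AddCommGroup M] [Module k M]
    (T : Module.End k M) (W : Submodule k M) [FiniteDimensional k W] (p : ℕ)
    (ι : ℕ → Type*) [∀ r, Finite (ι r)] (F : ∀ r, ι r → M)
    (hF : ∀ r < p, LinearIndependent k (F r))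
    (hT : ∀ r < p, ∀ s, T (F r s) = 0)
    (hW : ∀ r < p, ∀ s, ∃ e ∈ W, (T ^ r) e = F r s)
    (hdim : Module.finrank k W ≤ ∑ r ∈ Finset.range p, Nat.card (ι r)) (n : ℕ) (hn : n ≤ p) :
    Module.finrank k ↥(LinearMap.ker (T ^ n) ⊓ W) =
      ∑ r ∈ Finset.range n, Nat.card (ι r) := by
  have hfin (n : ℕ) : FiniteDimensional k ↥(LinearMap.ker (T ^ n) ⊓ W) :=
    Submodule.finiteDimensional_of_le inf_le_right
  have step (r : ℕ) (hr : r < p) : Module.finrank k ↥(LinearMap.ker (T ^ r) ⊓ W) + Nat.card (ι r) ≤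
      Module.finrank k ↥(LinearMap.ker (T ^ (r + 1)) ⊓ W) := by
    have := hfin (r + 1)
    have := Fintype.ofFinite (ι r)
    set K := LinearMap.ker (T ^ (r + 1)) ⊓ W with hK
    let f : K →ₗ[k] M := (T ^ r).domRestrict K
    have hmem (s : ι r) : F r s ∈ LinearMap.range f := by
      obtain ⟨e, he, hes⟩ := hW r hr s
      have he' : (T ^ (r + 1)) e = 0 := by rw [pow_succ', Module.End.mul_apply, hes, hT r hr s]
      exact ⟨⟨e, he', he⟩, hes⟩
    have hli : LinearIndependent k fun s => (⟨F r s, hmem s⟩ : LinearMap.range f) :=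
      LinearIndependent.of_comp (LinearMap.range f).subtype (hF r hr)
    have hker : Module.finrank k (LinearMap.ker f) =
        Module.finrank k ↥(LinearMap.ker (T ^ r) ⊓ W) := by
      refine LinearEquiv.finrank_eq (LinearEquiv.ofBijective
        ((K.subtype.comp (LinearMap.ker f).subtype).codRestrict
          (LinearMap.ker (T ^ r) ⊓ W) fun v => ⟨v.2, v.1.2.2⟩) ⟨?_, ?_⟩)
      · intro v w h
        have hvw : (v.1.1 : M) = w.1.1 :=
          congrArg (fun u : ↥(LinearMap.ker (T ^ r) ⊓ W) => (u : M)) h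
        exact Subtype.ext (Subtype.ext hvw)
      · rintro ⟨v, hv, hvW⟩
        have hv' : (T ^ (r + 1)) v = 0 := by
          rw [pow_succ', Module.End.mul_apply, LinearMap.mem_ker.1 hv, map_zero]
        exact ⟨⟨⟨v, hv', hvW⟩, hv⟩, rfl⟩
    have h1 := f.finrank_range_add_finrank_ker
    have h2 := hli.fintype_card_le_finrank
    rw [Nat.card_eq_fintype_card]
    omega
  have hle (m : ℕ) (hm : m ≤ p) : ∑ r ∈ Finset.range m, Nat.card (ι r) ≤
      Module.finrank k ↥(LinearMap.ker (T ^ m) ⊓ W) := by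
    induction m with
    | zero => simp
    | succ m ih =>
      rw [Finset.sum_range_succ]
      have := ih (by omega)
      have := step m hm
      omega
  have hge (m : ℕ) (hm : m ≤ p) : Module.finrank k ↥(LinearMap.ker (T ^ m) ⊓ W) +
      ∑ r ∈ Finset.Ico m p, Nat.card (ι r) ≤ Module.finrank k W := by
    induction hm using Nat.decreasingInduction with
    | self => simpa using Submodule.finrank_mono inf_le_right
    | of_succ m hm ih =>
      rw [Finset.sum_eq_sum_Ico_succ_bot hm]
      have := step m hm
      omega
  have h1 := hle n hn
  have h2 := hge n hn
  have h3 := Finset.sum_range_add_sum_Ico (fun r => Nat.card (ι r)) hn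
  omega

section Covariants

variable {k : Type*} [Field k]

lemma actL_apply (m n : ℕ) (φ : Fin n → MvPolynomial (Fin m) k) (i : Fin n) :
    actL k m n φ i = ∑ j : Fin n, if i ≤ j then
      (-1 : k) ^ ((j : ℕ) - (i : ℕ)) • sigmaHom k m (φ j) else 0 := by
  simp only [actL, LinearMap.pi_apply, LinearMap.sum_apply]
  refine Finset.sum_congr rfl fun j _ => ?_
  simp only [Fin.le_def]
  split_ifs <;> simp

lemma actL_apply_add_actL_apply_succ (m n : ℕ) (φ : Fin n → MvPolynomial (Fin m) k) (i : Fin n) :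
    actL k m n φ i + (if h : (i : ℕ) + 1 < n then actL k m n φ ⟨i + 1, h⟩ else 0) =
      sigmaHom k m (φ i) := by
  have hrest : (if h : (i : ℕ) + 1 < n then actL k m n φ ⟨i + 1, h⟩ else 0) =
      ∑ j : Fin n, if i < j then
        (-1 : k) ^ ((j : ℕ) - (i + 1 : ℕ)) • sigmaHom k m (φ j) else 0 := by
    split_ifs with h
    · rw [actL_apply]
      refine Finset.sum_congr rfl fun j _ => ?_
      simp only [Fin.le_def, Fin.lt_def, Nat.succ_le_iff]
    · refine (Finset.sum_eq_zero fun j _ => if_neg ?_).symm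
      rw [Fin.lt_def]
      omega
  rw [hrest, actL_apply, ← Finset.sum_add_distrib, Finset.sum_eq_single i]
  · simp
  · intro j _ hj
    rcases lt_or_gt_of_ne hj with h | h
    · simp [not_le.2 h, h.le]
    · rw [if_pos h.le, if_pos h, ← add_smul,
        show (j : ℕ) - i = (j - (i + 1)) + 1 by rw [Fin.lt_def] at h; omega, pow_succ]
      simp
  · simp

lemma actL_eq_self_iff (m n : ℕ) (φ : Fin n → MvPolynomial (Fin m) k) :
    actL k m n φ = φ ↔
      ∀ i : Fin n, delta k m (φ i) = if h : (i : ℕ) + 1 < n then φ ⟨i + 1, h⟩ else 0 := by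
  have hdelta (f : MvPolynomial (Fin m) k) : delta k m f = sigmaHom k m f - f := rfl
  constructor
  · intro h i
    have := actL_apply_add_actL_apply_succ m n φ i
    rw [h] at this
    rw [hdelta, ← this, add_sub_cancel_left]
  · intro h
    have key (t : ℕ) : ∀ i : Fin n, n - i = t → actL k m n φ i = φ i := by
      induction t with
      | zero => intro i hi; omega
      | succ t ih =>
        intro i hi
        have h1 := actL_apply_add_actL_apply_succ m n φ i
        have h2 := h i
        rw [hdelta] at h2
        split_ifs at h1 h2 with hlt
        · rw [ih ⟨i + 1, hlt⟩ (by simp; omega), ← h2] at h1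
          linear_combination h1
        · linear_combination h1 + h2
    exact funext fun i => key _ i rfl

lemma isHomogeneous_sigmaHom {m d : ℕ} {f : MvPolynomial (Fin m) k} (hf : f.IsHomogeneous d) :
    (sigmaHom k m f).IsHomogeneous d := by
  rw [← one_mul d]
  refine hf.aeval _ fun i => (isHomogeneous_X k i).add ?_
  split_ifs
  exacts [isHomogeneous_X k _, isHomogeneous_zero _ _ _]

lemma isHomogeneous_delta_pow {m d : ℕ} {f : MvPolynomial (Fin m) k} (hf : f.IsHomogeneous d)
    (r : ℕ) : ((delta k m ^ r) f).IsHomogeneous d := by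
  induction r with
  | zero => simpa
  | succ r ih =>
    rw [pow_succ', Module.End.mul_apply]
    exact (isHomogeneous_sigmaHom ih).sub ih

lemma finrank_covariants (m n d : ℕ) (hn : 1 ≤ n) :
    Module.finrank k ↥(LinearMap.ker (actL k m n - LinearMap.id) ⊓
      Submodule.pi Set.univ fun _ : Fin n => homogeneousSubmodule (Fin m) k d) =
    Module.finrank k ↥(LinearMap.ker (delta k m ^ n) ⊓ homogeneousSubmodule (Fin m) k d) := by
  let T := delta k m
  let L : MvPolynomial (Fin m) k →ₗ[k] (Fin n → MvPolynomial (Fin m) k) :=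
    LinearMap.pi fun i => T ^ (i : ℕ)
  symm
  have hmem (f : ↥(LinearMap.ker (T ^ n) ⊓ homogeneousSubmodule (Fin m) k d)) :
      L f ∈ LinearMap.ker (actL k m n - LinearMap.id) ⊓
        Submodule.pi Set.univ fun _ : Fin n => homogeneousSubmodule (Fin m) k d := by
    refine ⟨?_, fun i _ => isHomogeneous_delta_pow f.2.2 i⟩
    rw [SetLike.mem_coe, LinearMap.mem_ker, LinearMap.sub_apply, LinearMap.id_apply,
      sub_eq_zero, actL_eq_self_iff]
    intro i
    change T ((T ^ (i : ℕ)) f) = _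
    rw [← Module.End.mul_apply, ← pow_succ']
    split_ifs with h
    · rfl
    · rw [show (i : ℕ) + 1 = n by omega]
      exact f.2.1
  refine LinearEquiv.finrank_eq (LinearEquiv.ofBijective
    ((L.domRestrict _).codRestrict _ hmem) ⟨?_, ?_⟩)
  · intro f g h
    have := congrFun (congrArg Subtype.val h) ⟨0, hn⟩
    exact Subtype.ext this
  · rintro ⟨φ, hφ, hd⟩
    rw [SetLike.mem_coe, LinearMap.mem_ker, LinearMap.sub_apply, LinearMap.id_apply,
      sub_eq_zero, actL_eq_self_iff] at hφ
    have hpow (i : ℕ) (hi : i < n) : (T ^ i) (φ ⟨0, hn⟩) = φ ⟨i, hi⟩ := by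
      induction i with
      | zero => rfl
      | succ i ih =>
        rw [pow_succ', Module.End.mul_apply, ih (by omega), hφ, dif_pos hi]
    have hlast : (T ^ n) (φ ⟨0, hn⟩) = 0 := by
      obtain ⟨n, rfl⟩ := Nat.exists_eq_add_of_le' hn
      rw [pow_succ', Module.End.mul_apply, hpow n (by omega), hφ, dif_neg (by simp)]
    exact ⟨⟨φ ⟨0, hn⟩, hlast, hd _ trivial⟩, Subtype.ext (funext fun i => hpow i i.2)⟩

end Covariants

section Invariants

variable (k : Type*) [Field k]

/-- A shifted version `x_2 - x_3 / 2` of `x_2`, on which `σ` acts by `w ↦ w + x_3`. -/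
noncomputable def shiftedY : MvPolynomial (Fin 3) k := X 1 - C 2⁻¹ * X 2

/-- The quadratic invariant. -/
noncomputable def quadInvariant : MvPolynomial (Fin 3) k := shiftedY k ^ 2 - 2 * X 0 * X 2

/-- The norm of `x_2`, for `p = 2 * h + 1`. -/
noncomputable def normY (h : ℕ) : MvPolynomial (Fin 3) k :=
  shiftedY k ^ (2 * h + 1) - shiftedY k * X 2 ^ (2 * h)

/-- The norm of `x_1`, for `p = 2 * h + 1`. -/
noncomputable def normX (h : ℕ) : MvPolynomial (Fin 3) k :=
  ∏ c ∈ Finset.range (2 * h + 1), (sigmaHom k 3)^[c] (X 0)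

/-- The monomial `x_3 ^ i * q ^ j * N(x_2) ^ ε * N(x_1) ^ a` with `m = 2 * a + ε`, `ε ≤ 1`. -/
noncomputable def invariantMonomial (h : ℕ) (q : ℕ × ℕ × ℕ) : MvPolynomial (Fin 3) k :=
  X 2 ^ q.1 * quadInvariant k ^ q.2.1 * (normY k h ^ (q.2.2 % 2) * normX k h ^ (q.2.2 / 2))

variable {k}

lemma sigmaHom_X_zero : sigmaHom k 3 (X 0) = X 0 + X 1 := by simp [sigmaHom]

lemma sigmaHom_X_one : sigmaHom k 3 (X 1) = X 1 + X 2 := by simp [sigmaHom]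

lemma sigmaHom_X_two : sigmaHom k 3 (X 2) = X 2 := by simp [sigmaHom]

lemma sigmaHom_C (m : ℕ) (c : k) : sigmaHom k m (C c) = C c := (sigmaHom k m).commutes c

lemma sigmaHom_shiftedY : sigmaHom k 3 (shiftedY k) = shiftedY k + X 2 := by
  simp only [shiftedY, map_sub, map_mul, sigmaHom_X_one, sigmaHom_X_two, sigmaHom_C]
  ring

lemma C_inv_two_mul_two (h2 : (2 : k) ≠ 0) : (C 2⁻¹ : MvPolynomial (Fin 3) k) * 2 = 1 := by
  rw [← map_ofNat (C : k →+* MvPolynomial (Fin 3) k) 2, ← map_mul, inv_mul_cancel₀ h2, map_one]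

lemma sigmaHom_quadInvariant (h2 : (2 : k) ≠ 0) :
    sigmaHom k 3 (quadInvariant k) = quadInvariant k := by
  simp only [quadInvariant, map_sub, map_mul, map_pow, sigmaHom_X_zero, sigmaHom_X_two,
    sigmaHom_shiftedY, map_ofNat]
  simp only [shiftedY]
  linear_combination (-X 2 ^ 2 : MvPolynomial (Fin 3) k) * C_inv_two_mul_two h2

lemma sigmaHom_normY (h : ℕ) (hp : (2 * h + 1).Prime) [CharP k (2 * h + 1)] :
    sigmaHom k 3 (normY k h) = normY k h := by
  have := Fact.mk hp
  simp only [normY, map_sub, map_mul, map_pow, sigmaHom_X_two, sigmaHom_shiftedY,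
    add_pow_char _ _ (2 * h + 1)]
  ring

lemma two_mul_sigmaHom_iterate_X_zero (c : ℕ) :
    2 * (sigmaHom k 3)^[c] (X 0) =
      2 * X 0 + 2 * (c : MvPolynomial (Fin 3) k) * X 1 +
        (c : MvPolynomial (Fin 3) k) * ((c : MvPolynomial (Fin 3) k) - 1) * X 2 := by
  induction c with
  | zero => simp
  | succ c ih =>
    have h := congrArg (sigmaHom k 3) ih
    simp only [map_add, map_mul, map_sub, map_natCast, map_ofNat, map_one, sigmaHom_X_zero,
      sigmaHom_X_one, sigmaHom_X_two] at h
    rw [Function.iterate_succ_apply', h]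
    push_cast
    ring

lemma two_ne_zero_mvPolynomial (h2 : (2 : k) ≠ 0) : (2 : MvPolynomial (Fin 3) k) ≠ 0 := by
  rw [← map_ofNat (C : k →+* MvPolynomial (Fin 3) k) 2]
  simpa using h2

lemma sigmaHom_normX (h : ℕ) (h2 : (2 : k) ≠ 0) [CharP k (2 * h + 1)] :
    sigmaHom k 3 (normX k h) = normX k h := by
  have hper : (sigmaHom k 3)^[2 * h + 1] (X 0) = X 0 := by
    refine mul_left_cancel₀ (two_ne_zero_mvPolynomial h2) ?_
    rw [two_mul_sigmaHom_iterate_X_zero, CharP.cast_eq_zero]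
    ring
  rw [normX, map_prod]
  simp only [← Function.iterate_succ_apply' (sigmaHom k 3)]
  rw [Finset.prod_range_succ, hper, Finset.prod_range_succ' _ (2 * h)]
  simp

lemma isHomogeneous_shiftedY : (shiftedY k).IsHomogeneous 1 :=
  (isHomogeneous_X k _).sub ((isHomogeneous_X k _).C_mul _)

lemma isHomogeneous_quadInvariant : (quadInvariant k).IsHomogeneous 2 := by
  refine (isHomogeneous_shiftedY.pow 2).sub ?_
  rw [mul_assoc, ← map_ofNat (C : k →+* MvPolynomial (Fin 3) k) 2]
  exact ((isHomogeneous_X k _).mul (isHomogeneous_X k _)).C_mul _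

lemma isHomogeneous_normY (h : ℕ) : (normY k h).IsHomogeneous (2 * h + 1) := by
  refine IsHomogeneous.sub ?_ ?_
  · simpa using isHomogeneous_shiftedY.pow (2 * h + 1)
  · rw [add_comm]
    exact isHomogeneous_shiftedY.mul (isHomogeneous_X_pow _ _)

lemma isHomogeneous_normX (h : ℕ) : (normX k h).IsHomogeneous (2 * h + 1) := by
  have hc (c : ℕ) : ((sigmaHom k 3)^[c] (X 0)).IsHomogeneous 1 := by
    induction c with
    | zero => exact isHomogeneous_X k _
    | succ c ih =>
      rw [Function.iterate_succ_apply']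
      exact isHomogeneous_sigmaHom ih
  have := IsHomogeneous.prod (Finset.range (2 * h + 1)) _ (fun _ => 1) fun c _ => hc c
  simpa only [Finset.sum_const, Finset.card_range, smul_eq_mul, mul_one, normX] using this

lemma delta_eq_zero_iff {m : ℕ} {f : MvPolynomial (Fin m) k} :
    delta k m f = 0 ↔ sigmaHom k m f = f := sub_eq_zero

lemma delta_pow_mul {m : ℕ} {f : MvPolynomial (Fin m) k} (hf : sigmaHom k m f = f) (r : ℕ)
    (g : MvPolynomial (Fin m) k) : (delta k m ^ r) (f * g) = f * (delta k m ^ r) g := by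
  induction r with
  | zero => rfl
  | succ r ih =>
    rw [pow_succ', Module.End.mul_apply, Module.End.mul_apply, ih]
    simp only [delta, LinearMap.sub_apply, AlgHom.toLinearMap_apply, map_mul, hf,
      LinearMap.id_apply]
    ring

lemma delta_pow_succ_shiftedY_pow (r q : ℕ) : (delta k 3 ^ (r + 1)) (shiftedY k ^ q) =
    ∑ i ∈ Finset.range q, X 2 ^ (q - i) * (q.choose i : MvPolynomial (Fin 3) k) *
      (delta k 3 ^ r) (shiftedY k ^ i) := by
  have h : delta k 3 (shiftedY k ^ q) =
      ∑ i ∈ Finset.range q, (X 2 ^ (q - i) * (q.choose i : MvPolynomial (Fin 3) k)) *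
        shiftedY k ^ i := by
    change sigmaHom k 3 (shiftedY k ^ q) - shiftedY k ^ q = _
    rw [map_pow, sigmaHom_shiftedY, add_pow, Finset.sum_range_succ]
    simp only [Nat.sub_self, pow_zero, Nat.choose_self, Nat.cast_one, mul_one, add_sub_cancel_right]
    exact Finset.sum_congr rfl fun i _ => by ring
  rw [pow_succ, Module.End.mul_apply, h, map_sum]
  refine Finset.sum_congr rfl fun i _ => delta_pow_mul ?_ _ _
  simp [sigmaHom_X_two]

lemma delta_pow_shiftedY_pow_of_lt (r q : ℕ) (h : q < r) :
    (delta k 3 ^ r) (shiftedY k ^ q) = 0 := by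
  induction r generalizing q with
  | zero => omega
  | succ r ih =>
    rw [delta_pow_succ_shiftedY_pow]
    refine Finset.sum_eq_zero fun i hi => ?_
    rw [ih i (by have := Finset.mem_range.1 hi; omega), mul_zero]

lemma delta_pow_shiftedY_pow_self (r : ℕ) :
    (delta k 3 ^ r) (shiftedY k ^ r) = (r.factorial : MvPolynomial (Fin 3) k) * X 2 ^ r := by
  induction r with
  | zero => simp
  | succ r ih =>
    rw [delta_pow_succ_shiftedY_pow, Finset.sum_range_succ, ih, Finset.sum_eq_zero,
      Nat.factorial_succ]
    · simp
      ring
    · intro i hi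
      rw [delta_pow_shiftedY_pow_of_lt _ _ (Finset.mem_range.1 hi), mul_zero]

lemma delta_pow_shiftedY_pow_add (h : ℕ) (hp : (2 * h + 1).Prime) [CharP k (2 * h + 1)] (q : ℕ) :
    (delta k 3 ^ (2 * h)) (shiftedY k ^ (2 * h + 1 + q)) =
      normY k h * (delta k 3 ^ (2 * h)) (shiftedY k ^ q) +
        X 2 ^ (2 * h) * (delta k 3 ^ (2 * h)) (shiftedY k ^ (q + 1)) := by
  rw [← delta_pow_mul (sigmaHom_normY h hp), ← delta_pow_mul (f := X 2 ^ (2 * h))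
    (by rw [map_pow, sigmaHom_X_two]), ← map_add]
  congr 1
  simp only [normY]
  ring

lemma delta_pow_X_pow_mul_shiftedY_pow (h2 : (2 : k) ≠ 0) (r a e : ℕ) :
    (2 * X 2) ^ a * (delta k 3 ^ r) (X 0 ^ a * shiftedY k ^ e) =
      ∑ m ∈ Finset.range (a + 1), (-quadInvariant k) ^ (a - m) *
        (a.choose m : MvPolynomial (Fin 3) k) * (delta k 3 ^ r) (shiftedY k ^ (2 * m + e)) := by
  have hx : (2 * X 2) ^ a * (X 0 ^ a * shiftedY k ^ e) =
      ∑ m ∈ Finset.range (a + 1), ((-quadInvariant k) ^ (a - m) *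
        (a.choose m : MvPolynomial (Fin 3) k)) * shiftedY k ^ (2 * m + e) := by
    rw [← mul_assoc, ← mul_pow, show 2 * X 2 * X 0 = shiftedY k ^ 2 + -quadInvariant k by
      rw [quadInvariant]; ring, add_pow, Finset.sum_mul]
    exact Finset.sum_congr rfl fun m _ => by ring
  rw [← delta_pow_mul (by simp only [map_pow, map_mul, map_ofNat, sigmaHom_X_two]), hx, map_sum]
  refine Finset.sum_congr rfl fun m _ => delta_pow_mul ?_ _ _
  simp [sigmaHom_quadInvariant h2]

/-- `f` is the image under `Δ ^ r` of a homogeneous polynomial of degree `d`. -/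
def IsDeltaImage (r d : ℕ) (f : MvPolynomial (Fin 3) k) : Prop :=
  ∃ e : MvPolynomial (Fin 3) k, e.IsHomogeneous d ∧ (delta k 3 ^ r) e = f

namespace IsDeltaImage

variable {r d : ℕ} {f g : MvPolynomial (Fin 3) k}

lemma mul_left (hf : IsDeltaImage r d f) {d' : ℕ} (hg : sigmaHom k 3 g = g)
    (hd : g.IsHomogeneous d') : IsDeltaImage r (d' + d) (g * f) := by
  obtain ⟨e, he, rfl⟩ := hf
  exact ⟨g * e, hd.mul he, delta_pow_mul hg r e⟩

lemma mono (hf : IsDeltaImage r d f) {r' : ℕ} (hr : r' ≤ r) : IsDeltaImage r' d f := by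
  obtain ⟨e, he, rfl⟩ := hf
  obtain ⟨s, rfl⟩ := Nat.exists_eq_add_of_le hr
  exact ⟨(delta k 3 ^ s) e, isHomogeneous_delta_pow he s, by rw [pow_add, Module.End.mul_apply]⟩

lemma sub (hf : IsDeltaImage r d f) (hg : IsDeltaImage r d g) : IsDeltaImage r d (f - g) := by
  obtain ⟨e, he, rfl⟩ := hf
  obtain ⟨e', he', rfl⟩ := hg
  exact ⟨e - e', he.sub he', map_sub _ _ _⟩

lemma of_C_mul {c : k} (hc : c ≠ 0) (hf : IsDeltaImage r d (C c * f)) : IsDeltaImage r d f := by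
  have h := hf.mul_left (sigmaHom_C 3 c⁻¹) (isHomogeneous_C _ _)
  rwa [zero_add, ← mul_assoc, ← map_mul, inv_mul_cancel₀ hc, map_one, one_mul] at h

end IsDeltaImage

lemma natCast_factorial_ne_zero (h m : ℕ) (hm : m < 2 * h + 1) (hp : (2 * h + 1).Prime)
    [CharP k (2 * h + 1)] : (m.factorial : k) ≠ 0 := by
  rw [Ne, CharP.cast_eq_zero_iff k (2 * h + 1), hp.dvd_factorial]
  omega

lemma isDeltaImage_X_two_pow (l h : ℕ) (hl : l ≤ h) (hp : (2 * h + 1).Prime)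
    [CharP k (2 * h + 1)] (h2 : (2 : k) ≠ 0) :
    IsDeltaImage (2 * l) l (X 2 ^ l : MvPolynomial (Fin 3) k) := by
  have hX : (X 2 : MvPolynomial (Fin 3) k) ≠ 0 := X_ne_zero 2
  have hsum := delta_pow_X_pow_mul_shiftedY_pow h2 (2 * l) l 0
  rw [pow_zero, mul_one, Finset.sum_range_succ, Finset.sum_eq_zero, add_zero,
    delta_pow_shiftedY_pow_self] at hsum
  · refine .of_C_mul (natCast_factorial_ne_zero h (2 * l) (by omega) hp) ⟨C 2 ^ l * X 0 ^ l, ?_, ?_⟩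
    · rw [← map_pow]
      exact (isHomogeneous_X_pow _ _).C_mul _
    · rw [delta_pow_mul (by rw [map_pow, sigmaHom_C])]
      refine mul_left_cancel₀ (pow_ne_zero l hX) ?_
      rw [map_natCast, map_ofNat]
      simp only [Nat.sub_self, pow_zero, Nat.choose_self, Nat.cast_one, one_mul, zero_add] at hsum
      linear_combination hsum
  · intro m hm
    rw [delta_pow_shiftedY_pow_of_lt _ _ (by have := Finset.mem_range.1 hm; omega), mul_zero]

lemma delta_pow_shiftedY_pow_eq_zero (h : ℕ) (hp : (2 * h + 1).Prime) [CharP k (2 * h + 1)] (q : ℕ)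
    (hq : q ≠ 2 * h) (hq' : q < 4 * h) : (delta k 3 ^ (2 * h)) (shiftedY k ^ q) = 0 := by
  rcases lt_or_gt_of_ne hq with hlt | hgt
  · exact delta_pow_shiftedY_pow_of_lt _ _ hlt
  · obtain ⟨s, rfl⟩ := Nat.exists_eq_add_of_le (show 2 * h + 1 ≤ q from hgt)
    rw [delta_pow_shiftedY_pow_add h hp, delta_pow_shiftedY_pow_of_lt _ _ (by omega),
      delta_pow_shiftedY_pow_of_lt _ _ (by omega), mul_zero, mul_zero, add_zero]

lemma delta_pow_shiftedY_pow_four_mul (h : ℕ) (hp : (2 * h + 1).Prime) [CharP k (2 * h + 1)] :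
    (delta k 3 ^ (2 * h)) (shiftedY k ^ (4 * h)) =
      ((2 * h).factorial : MvPolynomial (Fin 3) k) * X 2 ^ (4 * h) := by
  have hh : h ≠ 0 := by rintro rfl; exact Nat.not_prime_one hp
  obtain ⟨s, rfl⟩ := Nat.exists_eq_succ_of_ne_zero hh
  rw [show 4 * s.succ = 2 * s.succ + 1 + (2 * s + 1) by omega, delta_pow_shiftedY_pow_add _ hp,
    delta_pow_shiftedY_pow_of_lt _ _ (by omega), show 2 * s + 1 + 1 = 2 * s.succ by omega,
    delta_pow_shiftedY_pow_self]
  simp only [Nat.succ_eq_add_one]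
  ring

lemma isDeltaImage_normY (h : ℕ) (hp : (2 * h + 1).Prime) [CharP k (2 * h + 1)]
    (h2 : (2 : k) ≠ 0) : IsDeltaImage (2 * h) (2 * h + 1) (normY k h) := by
  have hh : h ≠ 0 := by rintro rfl; exact Nat.not_prime_one hp
  have hX : (X 2 : MvPolynomial (Fin 3) k) ≠ 0 := X_ne_zero 2
  have hsum := delta_pow_X_pow_mul_shiftedY_pow h2 (2 * h) (2 * h) 1
  rw [Finset.sum_range_succ, Finset.sum_eq_zero, show 2 * (2 * h) + 1 = 2 * h + 1 + 2 * h by omega,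
    delta_pow_shiftedY_pow_add h hp, delta_pow_shiftedY_pow_self,
    delta_pow_shiftedY_pow_eq_zero h hp (2 * h + 1) (by omega) (by omega)] at hsum
  · refine .of_C_mul (natCast_factorial_ne_zero h (2 * h) (by omega) hp)
      ⟨C 2 ^ (2 * h) * (X 0 ^ (2 * h) * shiftedY k ^ 1), ?_, ?_⟩
    · rw [← map_pow]
      exact ((isHomogeneous_X_pow _ _).mul (isHomogeneous_shiftedY.pow 1)).C_mul _
    · rw [delta_pow_mul (by rw [map_pow, sigmaHom_C])]
      refine mul_left_cancel₀ (pow_ne_zero (2 * h) hX) ?_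
      rw [map_natCast, map_ofNat]
      simp only [Nat.sub_self, pow_zero, Nat.choose_self, Nat.cast_one, one_mul, zero_add] at hsum
      linear_combination hsum
  · intro m hm
    have := Finset.mem_range.1 hm
    rw [delta_pow_shiftedY_pow_eq_zero h hp _ (by omega) (by omega), mul_zero]

lemma isDeltaImage_X_two_pow_mul_quadInvariant_pow (h : ℕ) (hp : (2 * h + 1).Prime)
    [CharP k (2 * h + 1)] (h2 : (2 : k) ≠ 0) (i : ℕ) (hi : i ≤ h) :
    IsDeltaImage (2 * h) (2 * h - i) (X 2 ^ i * quadInvariant k ^ (h - i)) := by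
  have hh : h ≠ 0 := by rintro rfl; exact Nat.not_prime_one hp
  have hX : (X 2 : MvPolynomial (Fin 3) k) ≠ 0 := X_ne_zero 2
  have hsum := delta_pow_X_pow_mul_shiftedY_pow h2 (2 * h) (2 * h - i) 0
  have hhom : ((C 2 : MvPolynomial (Fin 3) k) ^ (2 * h - i) * X 0 ^ (2 * h - i)).IsHomogeneous
      (2 * h - i) := by
    rw [← map_pow]
    exact (isHomogeneous_X_pow _ _).C_mul _
  have hc : (-1) ^ (h - i) * (((2 * h - i).choose h * (2 * h).factorial : ℕ) : k) ≠ 0 := by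
    refine mul_ne_zero (pow_ne_zero _ (neg_ne_zero.2 one_ne_zero)) ?_
    rw [Nat.cast_mul]
    refine mul_ne_zero (fun h0 => ?_) (natCast_factorial_ne_zero h (2 * h) (by omega) hp)
    have h1 := natCast_factorial_ne_zero (k := k) h (2 * h - i) (by omega) hp
    rw [← Nat.choose_mul_factorial_mul_factorial (show h ≤ 2 * h - i by omega), Nat.cast_mul,
      Nat.cast_mul, h0] at h1
    simp at h1
  refine .of_C_mul hc ?_
  have hpow : (-quadInvariant k) ^ (h - i) = (-1) ^ (h - i) * quadInvariant k ^ (h - i) :=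
    neg_pow _ _
  rcases Nat.eq_zero_or_pos i with rfl | hi0
  · have hz : IsDeltaImage (2 * h) (2 * h)
        (C ((2 * h).factorial : k) * (X 2 ^ h * X 2 ^ h) : MvPolynomial (Fin 3) k) := by
      have h1 := (isDeltaImage_X_two_pow h h le_rfl hp h2).mul_left (g := X 2 ^ h)
        (by rw [map_pow, sigmaHom_X_two]) (isHomogeneous_X_pow _ _)
      have h3 := h1.mul_left (sigmaHom_C 3 ((2 * h).factorial : k)) (isHomogeneous_C _ _)
      rwa [zero_add, ← two_mul] at h3
    have hdiff {f g : MvPolynomial (Fin 3) k} (hg : IsDeltaImage (2 * h) (2 * h) g)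
        (hfg : IsDeltaImage (2 * h) (2 * h) (f + g)) : IsDeltaImage (2 * h) (2 * h) f := by
      simpa using hfg.sub hg
    rw [Nat.sub_zero] at hsum hhom hpow ⊢
    refine hdiff hz ⟨_, hhom, ?_⟩
    rw [delta_pow_mul (by rw [map_pow, sigmaHom_C])]
    rw [Finset.sum_range_succ, Finset.sum_eq_single h, add_zero, delta_pow_shiftedY_pow_self,
      show 2 * h - h = h by omega, hpow, pow_zero, mul_one,
      show 2 * (2 * h) + 0 = 4 * h by omega, delta_pow_shiftedY_pow_four_mul h hp, Nat.sub_self,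
      pow_zero, Nat.choose_self] at hsum
    · refine mul_left_cancel₀ (pow_ne_zero (2 * h) hX) ?_
      simp only [map_natCast, map_ofNat, map_mul, map_pow, map_neg, map_one, Nat.cast_mul]
      linear_combination hsum
    · intro m hm hmh
      have := Finset.mem_range.1 hm
      rw [delta_pow_shiftedY_pow_eq_zero h hp _ (by omega) (by omega), mul_zero]
    · intro hm
      exact absurd (Finset.mem_range.2 (by omega)) hm
  · refine ⟨_, hhom, ?_⟩
    rw [delta_pow_mul (by rw [map_pow, sigmaHom_C])]
    rw [Finset.sum_eq_single h, add_zero, delta_pow_shiftedY_pow_self,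
      show 2 * h - i - h = h - i by omega, hpow, pow_zero, mul_one] at hsum
    · refine mul_left_cancel₀ (pow_ne_zero (2 * h - i) hX) ?_
      have hXX : (X 2 : MvPolynomial (Fin 3) k) ^ (2 * h) = X 2 ^ (2 * h - i) * X 2 ^ i := by
        rw [← pow_add]
        congr 1
        omega
      simp only [map_natCast, map_ofNat, map_mul, map_pow, map_neg, map_one, Nat.cast_mul]
      rw [hXX] at hsum
      linear_combination hsum
    · intro m hm hmh
      have := Finset.mem_range.1 hm
      rw [delta_pow_shiftedY_pow_eq_zero h hp _ (by omega) (by omega), mul_zero]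
    · intro hm
      exact absurd (Finset.mem_range.2 (by omega)) hm

lemma sigmaHom_invariantMonomial (h : ℕ) (hp : (2 * h + 1).Prime) [CharP k (2 * h + 1)]
    (h2 : (2 : k) ≠ 0) (q : ℕ × ℕ × ℕ) :
    sigmaHom k 3 (invariantMonomial k h q) = invariantMonomial k h q := by
  simp only [invariantMonomial, map_mul, map_pow, sigmaHom_X_two, sigmaHom_quadInvariant h2,
    sigmaHom_normY h hp, sigmaHom_normX h h2]

lemma isHomogeneous_invariantMonomial (h : ℕ) (q : ℕ × ℕ × ℕ) :
    (invariantMonomial k h q).IsHomogeneous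
      (q.1 + 2 * q.2.1 + ((2 * h + 1) * (q.2.2 % 2) + (2 * h + 1) * (q.2.2 / 2))) :=
  ((isHomogeneous_X_pow _ _).mul (isHomogeneous_quadInvariant.pow _)).mul
    (((isHomogeneous_normY h).pow _).mul ((isHomogeneous_normX h).pow _))

/-- The substitution setting `x_3 = 1`, with the quadratic invariant and the shifted second
coordinate as new variables. -/
noncomputable def dehomogenize (k : Type*) [Field k] :
    MvPolynomial (Fin 3) k →ₐ[k] Polynomial (Polynomial k) :=
  aeval ![Polynomial.C (Polynomial.C 2⁻¹) * (Polynomial.X ^ 2 - Polynomial.C Polynomial.X),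
    Polynomial.X + Polynomial.C (Polynomial.C 2⁻¹), 1]

lemma two_mul_C_C_inv_two (h2 : (2 : k) ≠ 0) :
    (2 : Polynomial (Polynomial k)) * Polynomial.C (Polynomial.C 2⁻¹) = 1 := by
  rw [← map_ofNat (Polynomial.C : Polynomial k →+* _) 2,
    ← map_ofNat (Polynomial.C : k →+* _) 2, ← map_mul, ← map_mul, mul_inv_cancel₀ h2, map_one,
    map_one]

lemma dehomogenize_X_zero : dehomogenize k (X 0) =
    Polynomial.C (Polynomial.C 2⁻¹) * (Polynomial.X ^ 2 - Polynomial.C Polynomial.X) := by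
  simp [dehomogenize]

lemma dehomogenize_X_one : dehomogenize k (X 1) =
    Polynomial.X + Polynomial.C (Polynomial.C 2⁻¹) := by
  simp [dehomogenize]

lemma dehomogenize_X_two : dehomogenize k (X 2) = 1 := by
  simp [dehomogenize]

lemma dehomogenize_shiftedY : dehomogenize k (shiftedY k) = Polynomial.X := by
  rw [shiftedY, map_sub, map_mul, dehomogenize_X_one, dehomogenize_X_two, mul_one,
    show dehomogenize k (C 2⁻¹) = Polynomial.C (Polynomial.C 2⁻¹) from (dehomogenize k).commutes _,
    add_sub_cancel_right]

lemma dehomogenize_quadInvariant (h2 : (2 : k) ≠ 0) :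
    dehomogenize k (quadInvariant k) = Polynomial.C Polynomial.X := by
  rw [quadInvariant, map_sub, map_pow, map_mul, map_mul, map_ofNat, dehomogenize_shiftedY,
    dehomogenize_X_zero, dehomogenize_X_two, ← mul_assoc, two_mul_C_C_inv_two h2]
  ring

lemma dehomogenize_sigmaHom_iterate (h2 : (2 : k) ≠ 0) (c : ℕ) :
    dehomogenize k ((sigmaHom k 3)^[c] (X 0)) = Polynomial.C (Polynomial.C 2⁻¹) *
      ((Polynomial.X + Polynomial.C (c : Polynomial k)) ^ 2 - Polynomial.C Polynomial.X) := by
  have h := congrArg (dehomogenize k) (two_mul_sigmaHom_iterate_X_zero (k := k) c)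
  simp only [map_add, map_mul, map_sub, map_natCast, map_ofNat, map_one, dehomogenize_X_zero,
    dehomogenize_X_one, dehomogenize_X_two] at h
  have h1 := two_mul_C_C_inv_two h2
  simp only [map_natCast]
  linear_combination Polynomial.C (Polynomial.C 2⁻¹) * h +
    (-(dehomogenize k ((sigmaHom k 3)^[c] (X 0))) + Polynomial.C (Polynomial.C 2⁻¹) *
      (Polynomial.X ^ 2 - Polynomial.C Polynomial.X) +
      (c : Polynomial (Polynomial k)) * Polynomial.C (Polynomial.C 2⁻¹)) * h1

lemma natDegree_dehomogenize_sigmaHom_iterate (h2 : (2 : k) ≠ 0) (c : ℕ) :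
    (dehomogenize k ((sigmaHom k 3)^[c] (X 0))).natDegree = 2 := by
  rw [dehomogenize_sigmaHom_iterate h2, Polynomial.natDegree_C_mul (by simpa using h2),
    Polynomial.natDegree_sub_C, Polynomial.natDegree_pow, Polynomial.natDegree_X_add_C]

lemma natDegree_dehomogenize_normX (h : ℕ) (h2 : (2 : k) ≠ 0) :
    (dehomogenize k (normX k h)).natDegree = 2 * (2 * h + 1) := by
  have hdeg := natDegree_dehomogenize_sigmaHom_iterate h2
  rw [normX, map_prod, Polynomial.natDegree_prod _ _ fun c _ h0 => by simpa [h0] using hdeg c]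
  simp [hdeg, mul_comm]

lemma natDegree_dehomogenize_normY (h : ℕ) (hh : h ≠ 0) :
    (dehomogenize k (normY k h)).natDegree = 2 * h + 1 := by
  rw [normY, map_sub, map_mul, map_pow, map_pow, dehomogenize_shiftedY, dehomogenize_X_two,
    one_pow, mul_one]
  rw [Polynomial.natDegree_sub_eq_left_of_natDegree_lt] <;> simp [Nat.pos_of_ne_zero hh]

/-- Polynomials of degrees `0, p, 2 p, …` over a domain are linearly independent. -/
lemma linearIndependent_of_natDegree_eq_mul {R : Type*} [CommRing R] [IsDomain R] (p : ℕ)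
    (hp : 0 < p) (b : ℕ → Polynomial R) (hb : ∀ m, b m ≠ 0)
    (hdeg : ∀ m, (b m).natDegree = p * m) : LinearIndependent R b := by
  let S : Polynomial.Sequence R :=
    { elems' i := b (i / p) * Polynomial.X ^ (i % p)
      degree_eq' i := by
        rw [Polynomial.degree_mul, Polynomial.degree_X_pow,
          Polynomial.degree_eq_natDegree (hb _), hdeg]
        norm_cast
        exact Nat.div_add_mod i p }
  have hS (m : ℕ) : S (p * m) = b m := by
    change b (p * m / p) * Polynomial.X ^ (p * m % p) = b m
    simp [Nat.mul_div_cancel_left m hp]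
  have := S.linearIndependent.comp (p * ·) (mul_right_injective₀ hp.ne')
  rwa [show ⇑S ∘ (p * ·) = b from funext hS] at this

lemma linearIndependent_invariantMonomial {ι : Type*} (h : ℕ) (hh : h ≠ 0) (h2 : (2 : k) ≠ 0)
    (q : ι → ℕ × ℕ × ℕ) (hq : Function.Injective fun s => (q s).2) :
    LinearIndependent k fun s => invariantMonomial k h (q s) := by
  have hX := natDegree_dehomogenize_normX h h2
  have hY := natDegree_dehomogenize_normY (k := k) h hh
  have hX0 : dehomogenize k (normX k h) ≠ 0 := fun h0 => by simp [h0] at hX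
  have hY0 : dehomogenize k (normY k h) ≠ 0 := fun h0 => by simp [h0] at hY
  have hb := linearIndependent_of_natDegree_eq_mul (2 * h + 1) (Nat.succ_pos _)
    (fun m => dehomogenize k (normY k h) ^ (m % 2) * dehomogenize k (normX k h) ^ (m / 2))
    (fun m => mul_ne_zero (pow_ne_zero _ hY0) (pow_ne_zero _ hX0)) (fun m => by
      rw [Polynomial.natDegree_mul (pow_ne_zero _ hY0) (pow_ne_zero _ hX0),
        Polynomial.natDegree_pow, Polynomial.natDegree_pow, hX, hY]
      nth_rewrite 3 [← Nat.mod_add_div m 2]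
      ring)
  have hE : LinearIndependent k fun j : ℕ => (Polynomial.X : Polynomial k) ^ j := by
    simpa [Polynomial.X_pow_eq_monomial] using (Polynomial.basisMonomials k).linearIndependent
  refine LinearIndependent.of_comp (dehomogenize k).toLinearMap ?_
  have hcomp : (⇑(dehomogenize k).toLinearMap ∘ fun s => invariantMonomial k h (q s)) =
      (fun m : ℕ × ℕ => (Polynomial.X : Polynomial k) ^ m.1 •
        (dehomogenize k (normY k h) ^ (m.2 % 2) * dehomogenize k (normX k h) ^ (m.2 / 2))) ∘
        fun s => (q s).2 := by
    funext s
    simp only [Function.comp_apply, invariantMonomial, AlgHom.toLinearMap_apply, map_mul, map_pow,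
      dehomogenize_X_two, dehomogenize_quadInvariant h2, Polynomial.smul_eq_C_mul, one_pow, one_mul]
  rw [hcomp]
  exact (linearIndependent_smul hE hb).comp _ hq

/-- The exponents of the socle element attached to an index. -/
def JordanIndex.exponents (h l : ℕ) : JordanIndex l → ℕ × ℕ × ℕ
  | (a, .inl (i, j, true)) => (i, j, 2 * a + 1)
  | (a, .inl (i, j, false)) => (l + i, j, 2 * a)
  | (a, .inr (j, i)) => (i, h - i + j, 2 * a)

lemma JordanIndex.deg_eq (h l : ℕ) (hl : l ≤ h) (s : JordanIndex l) :
    JordanIndex.deg (2 * h + 1) l s = (exponents h l s).1 + 2 * (exponents h l s).2.1 +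
      ((2 * h + 1) * ((exponents h l s).2.2 % 2) + (2 * h + 1) * ((exponents h l s).2.2 / 2)) := by
  match s with
  | (a, .inl (i, j, true)) =>
    simp [deg, exponents, coneDeg, show (2 * a + 1) / 2 = a by omega, Nat.add_mod]
    ring
  | (a, .inl (i, j, false)) =>
    simp [deg, exponents, coneDeg]
    ring
  | (a, .inr (j, i)) =>
    have := i.2
    simp [deg, exponents, coneDeg]
    omega

lemma JordanIndex.exponents_injective (h l d : ℕ) (hl : l ≤ h) :
    Function.Injective fun s : {s // JordanIndex.deg (2 * h + 1) l s = d} =>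
      (exponents h l s).2 := by
  rintro ⟨s, hs⟩ ⟨t, ht⟩ hst
  rw [deg_eq h l hl] at hs ht
  have h1 : (exponents h l s).1 = (exponents h l t).1 := by
    simp only at hst
    rw [hst] at hs
    omega
  have hst' : exponents h l s = exponents h l t := Prod.ext h1 hst
  clear hs ht hst h1
  rw [Subtype.mk.injEq]
  match s, t with
  | (a, .inl (i, j, true)), (a', .inl (i', j', true)) => simp [exponents] at hst'; simp; omega
  | (a, .inl (i, j, true)), (a', .inl (i', j', false)) => simp [exponents] at hst'; omega
  | (a, .inl (i, j, true)), (a', .inr (j', i')) => simp [exponents] at hst'; omega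
  | (a, .inl (i, j, false)), (a', .inl (i', j', true)) => simp [exponents] at hst'; omega
  | (a, .inl (i, j, false)), (a', .inl (i', j', false)) => simp [exponents] at hst'; simp; omega
  | (a, .inl (i, j, false)), (a', .inr (j', i')) => simp [exponents] at hst'; omega
  | (a, .inr (j, i)), (a', .inl (i', j', true)) => simp [exponents] at hst'; omega
  | (a, .inr (j, i)), (a', .inl (i', j', false)) => simp [exponents] at hst'; omega
  | (a, .inr (j, i)), (a', .inr (j', i')) => simp [exponents] at hst'; simp [Fin.ext_iff]; omega

lemma isDeltaImage_invariantMonomial (h r : ℕ) (hr : r ≤ 2 * h) (hp : (2 * h + 1).Prime)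
    [CharP k (2 * h + 1)] (h2 : (2 : k) ≠ 0) (s : JordanIndex ((r + 1) / 2)) :
    IsDeltaImage r (JordanIndex.deg (2 * h + 1) ((r + 1) / 2) s)
      (invariantMonomial k h (JordanIndex.exponents h _ s)) := by
  have hmul (q : ℕ × ℕ × ℕ) {d : ℕ} {f : MvPolynomial (Fin 3) k} (hf : IsDeltaImage r d f) :=
    hf.mul_left (sigmaHom_invariantMonomial h hp h2 q) (isHomogeneous_invariantMonomial h q)
  match s with
  | (a, .inl (i, j, true)) =>
    convert hmul (i, j, 2 * a) ((isDeltaImage_normY h hp h2).mono hr) using 1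
    · simp [JordanIndex.deg, coneDeg]
      ring
    · simp [invariantMonomial, JordanIndex.exponents, Nat.add_mod,
        show (2 * a + 1) / 2 = a by omega]
      ring
  | (a, .inl (i, j, false)) =>
    convert hmul (i, j, 2 * a) ((isDeltaImage_X_two_pow ((r + 1) / 2) h (by omega) hp h2).mono
      (show r ≤ _ by omega)) using 1
    · simp [JordanIndex.deg, coneDeg]
      ring
    · simp [invariantMonomial, JordanIndex.exponents]
      ring
  | (a, .inr (j, i)) =>
    convert hmul (0, j, 2 * a) ((isDeltaImage_X_two_pow_mul_quadInvariant_pow h hp h2 i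
      (by have := i.2; omega)).mono hr) using 1
    · simp [JordanIndex.deg, coneDeg]
      ring
    · simp [invariantMonomial, JordanIndex.exponents]
      ring

end Invariants

/-- The degree on the exponents of the monomials in three variables. -/
def expDeg : ℕ × ℕ × ℕ × Unit → ℕ := coneDeg 1 (coneDeg 1 (coneDeg 1 fun _ => 0))

lemma finrank_homogeneousSubmodule (k : Type*) [Field k] (d : ℕ) :
    Module.finrank k (homogeneousSubmodule (Fin 3) k d) = Nat.card {q // expDeg q = d} := by
  let e : (Fin 3 → ℕ) ≃ ℕ × ℕ × ℕ × Unit :=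
    { toFun f := (f 0, f 1, f 2, ())
      invFun q := ![q.1, q.2.1, q.2.2.1]
      left_inv f := by ext i; fin_cases i <;> rfl
      right_inv _ := rfl }
  have hd (m : Fin 3 →₀ ℕ) : m ∈ {m : Fin 3 →₀ ℕ | m.degree = d} ↔
      expDeg (Finsupp.equivFunOnFinite.trans e m) = d := by
    change m.degree = d ↔ 1 * m 0 + (1 * m 1 + (1 * m 2 + 0)) = d
    simp [Finsupp.degree_eq_sum, Fin.sum_univ_three, add_assoc]
  let E : {m : Fin 3 →₀ ℕ | m.degree = d} ≃ {q // expDeg q = d} :=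
    (Finsupp.equivFunOnFinite.trans e).subtypeEquiv hd
  have : Finite {q // expDeg q = d} :=
    finite_fiber_coneDeg 1 one_pos _ (finite_fiber_coneDeg 1 one_pos _
      (finite_fiber_coneDeg 1 one_pos _ fun _ => inferInstance)) d
  have := Finite.of_equiv _ E.symm
  have := Fintype.ofFinite {m : Fin 3 →₀ ℕ | m.degree = d}
  rw [homogeneousSubmodule_eq_finsupp_supported,
    (AddMonoidAlgebra.supportedEquivFinsupp _).finrank_eq, Module.finrank_finsupp_self,
    ← Nat.card_congr E, Nat.card_eq_fintype_card]

lemma fiberSeries_expDeg (p : ℕ) (hodd : Odd p) :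
    fiberSeries expDeg = ∑ r ∈ Finset.range p, fiberSeries (JordanIndex.deg p ((r + 1) / 2)) := by
  have h1 := finite_fiber_coneDeg 1 one_pos (fun _ : Unit => 0) fun _ => inferInstance
  have h0 := one_sub_X_pow_ne_zero 1 one_pos
  refine mul_left_cancel₀ h0 (mul_left_cancel₀ h0 (mul_left_cancel₀ h0 ?_))
  rw [sum_fiberSeries_jordanIndex p hodd, expDeg,
    one_sub_X_pow_mul_fiberSeries_coneDeg 1 one_pos _ (finite_fiber_coneDeg 1 one_pos _ h1),
    one_sub_X_pow_mul_fiberSeries_coneDeg 1 one_pos _ h1,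
    one_sub_X_pow_mul_fiberSeries_coneDeg 1 one_pos _ fun _ => inferInstance, fiberSeries_fintype]
  simp

lemma covHilbert_eq_sum_fiberSeries (k : Type*) [Field k] (h : ℕ) (hp : (2 * h + 1).Prime)
    [CharP k (2 * h + 1)] (n : ℕ) (hn : 1 ≤ n) (hnp : n ≤ 2 * h + 1) :
    covHilbert k n =
      ∑ r ∈ Finset.range n, fiberSeries (JordanIndex.deg (2 * h + 1) ((r + 1) / 2)) := by
  have hh : h ≠ 0 := by rintro rfl; exact Nat.not_prime_one hp
  have h2 : (2 : k) ≠ 0 := by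
    simpa using natCast_factorial_ne_zero (k := k) h 2 (by omega) hp
  ext d
  have (l : ℕ) : Finite {s // JordanIndex.deg (2 * h + 1) l s = d} :=
    JordanIndex.finite_fiber _ _ hp.pos d
  have : FiniteDimensional k (homogeneousSubmodule (Fin 3) k d) :=
    Module.Finite.iff_fg.2 (homogeneousSubmodule_fg _ _ d)
  have hdim : Module.finrank k (homogeneousSubmodule (Fin 3) k d) =
      ∑ r ∈ Finset.range (2 * h + 1),
        Nat.card {s // JordanIndex.deg (2 * h + 1) ((r + 1) / 2) s = d} := by
    have hs := congrArg (PowerSeries.coeff d) (fiberSeries_expDeg (2 * h + 1) ⟨h, rfl⟩)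
    simp only [map_sum, fiberSeries, PowerSeries.coeff_mk] at hs
    rw [finrank_homogeneousSubmodule]
    exact_mod_cast hs
  rw [covHilbert, PowerSeries.coeff_mk, finrank_covariants 3 n d hn,
    finrank_ker_pow_inf_eq_sum (delta k 3) _ (2 * h + 1)
      (fun r => {s // JordanIndex.deg (2 * h + 1) ((r + 1) / 2) s = d})
      (fun r s => invariantMonomial k h (JordanIndex.exponents h _ s.1))
      (fun r hr => linearIndependent_invariantMonomial h hh h2 _
        (JordanIndex.exponents_injective h _ d (by omega)))
      (fun r _ s => delta_eq_zero_iff.2 (sigmaHom_invariantMonomial h hp h2 _))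
      (fun r hr s => by
        obtain ⟨s, rfl⟩ := s
        exact isDeltaImage_invariantMonomial h r (by omega) hp h2 s)
      hdim.le n hnp]
  simp [fiberSeries]

/-- Let `p` be an odd prime, `1 ≤ n ≤ p`, `l = n/2` if `n` is even and
`l = (n−1)/2` if `n` is odd.  Then `(1−t)(1−t^2)(1−t^p)·H(k[V_3]^G(V_n),t)`
equals `1 + 2t + … + 2t^l + 2t^{p−l} + … + 2t^{p−1} + t^p` if `n` is odd, and
`1 + 2t + … + 2t^{l−1} + t^l + t^{p−l} + 2t^{p−l+1} + … + 2t^{p−1} + t^p`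
if `n` is even. -/
theorem statement14 (p : ℕ) (hp : p.Prime) (hodd : Odd p)
    (k : Type*) [Field k] [CharP k p]
    (n : ℕ) (hn : 1 ≤ n) (hnp : n ≤ p) (l : ℕ) (hl : l = n / 2) :
    (Odd n →
      (1 - PowerSeries.X) * (1 - PowerSeries.X ^ 2) * (1 - PowerSeries.X ^ p) *
        covHilbert k n =
      1 + (∑ i ∈ Finset.Icc 1 l, 2 * PowerSeries.X ^ i)
        + (∑ i ∈ Finset.Icc (p - l) (p - 1), 2 * PowerSeries.X ^ i)
        + (PowerSeries.X : PowerSeries ℤ) ^ p) ∧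
    (Even n →
      (1 - PowerSeries.X) * (1 - PowerSeries.X ^ 2) * (1 - PowerSeries.X ^ p) *
        covHilbert k n =
      1 + (∑ i ∈ Finset.Icc 1 (l - 1), 2 * PowerSeries.X ^ i)
        + PowerSeries.X ^ l + PowerSeries.X ^ (p - l)
        + (∑ i ∈ Finset.Icc (p - l + 1) (p - 1), 2 * PowerSeries.X ^ i)
        + (PowerSeries.X : PowerSeries ℤ) ^ p) := by
  obtain ⟨h, rfl⟩ := hodd
  rw [covHilbert_eq_sum_fiberSeries k h hp n hn hnp, Finset.mul_sum,
    Finset.sum_congr rfl fun r hr => JordanIndex.fiberSeries_deg (2 * h + 1) ((r + 1) / 2)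
      (by have := Finset.mem_range.1 hr; omega)]
  refine ⟨?_, ?_⟩
  · rintro ⟨m, rfl⟩
    obtain rfl : l = m := by omega
    exact sum_range_X_pow_add_X_pow_sub _ l hnp
  · rintro ⟨m, rfl⟩
    obtain ⟨m, rfl⟩ := Nat.exists_eq_succ_of_ne_zero (show m ≠ 0 by omega)
    obtain rfl : l = m + 1 := by omega
    rw [show m.succ + m.succ = 2 * m + 1 + 1 by omega, Finset.sum_range_succ,
      sum_range_X_pow_add_X_pow_sub _ m (by omega),
      show (2 * m + 1 + 1) / 2 = m + 1 by omega, show m + 1 - 1 = m by omega,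
      show 2 * h + 1 - (m + 1) + 1 = 2 * h + 1 - m by omega]
    ring
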